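/- Let n ∈ ℕ, let (M, f, s, mx, le, zero) be an interpretation satisfying the NiA clause set C(n), and let b : {0, …, n} → {0, …, n} be a bijection. Then for every k ≤ n, every assignment x : ℕ → M, and every z : M: if f (x (b i)) = num (b i) for all i ≤ k, then there exists i with k < i ≤ n and f (m n x z) = num (b i). (Semantic content of: the clause c_b(k, n, z) is derivable by resolution from C(n).) -/

import Mathlib

/-- Numerals in the interpretation: `num 0 = zero`, `num (k+1) = s (num k)`. -/
def num {M : Type*} (s : M → M) (zero : M) : ℕ → M
  | 0 => zero
  | k + 1 => s (num s zero k)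

/-- The iterated max term `m(k, x̄, t)`. -/
def itm {M : Type*} (s : M → M) (mx : M → M → M) : ℕ → (ℕ → M) → M → M
  | 0, _, t => t
  | k + 1, x, t => itm s mx k x (mx (s (x (k + 1))) t)

/-- A chain in which each term is the maximum of its predecessor and the successor of that
predecessor. -/
def succMaxChain {M : Type*} (s : M → M) (mx : M → M → M) (z : M) : ℕ → M
  | 0 => z
  | k + 1 => mx (s (succMaxChain s mx z k)) (succMaxChain s mx z k)

theorem le_of_succMaxChain_add_le {M : Type*} {s : M → M} {mx : M → M → M} {le : M → M → Prop}
    (hright : ∀ a b c, le (mx a b) c → le b c) (z c : M) (i d : ℕ)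
    (h : le (succMaxChain s mx z (i + d)) c) : le (succMaxChain s mx z i) c := by
  induction d with
  | zero => exact h
  | succ d ih => exact ih (hright _ _ _ h)

theorem succ_succMaxChain_le_of_lt {M : Type*} {s : M → M} {mx : M → M → M} {le : M → M → Prop}
    (hrefl : ∀ a, le a a) (hleft : ∀ a b c, le (mx a b) c → le a c)
    (hright : ∀ a b c, le (mx a b) c → le b c) (z : M) {i j : ℕ} (hij : i < j) :
    le (s (succMaxChain s mx z i)) (succMaxChain s mx z j) := by
  obtain ⟨d, rfl⟩ := Nat.exists_eq_add_of_le (Nat.succ_le_of_lt hij)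
  exact hleft _ _ _ (le_of_succMaxChain_add_le hright z _ (i + 1) d (hrefl _))

/-- The clause set has no model: along a `succMaxChain` the function `f` would take
finitely many values without repetition. -/
theorem clauseSet_unsatisfiable {M : Type*} (n : ℕ) (f s : M → M) (mx : M → M → M)
    (le : M → M → Prop) (zero : M)
    (hrefl : ∀ a, le a a)
    (hleft : ∀ a b c, le (mx a b) c → le a c)
    (hright : ∀ a b c, le (mx a b) c → le b c)
    (hne : ∀ k ≤ n, ∀ a b, ¬ (f b = num s zero k ∧ f a = num s zero k ∧ le (s b) a))
    (hval : ∀ a, ∃ i ≤ n, f a = num s zero i) : False := by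
  choose g hgn hg using hval
  obtain ⟨i, j, hij, hgij⟩ := Finite.exists_ne_map_eq_of_infinite
    fun k : ℕ => (⟨g (succMaxChain s mx zero k), Nat.lt_succ_of_le (hgn _)⟩ : Fin (n + 1))
  wlog hlt : i < j generalizing i j
  · exact this j i hij.symm hgij.symm (by omega)
  have hgeq : g (succMaxChain s mx zero i) = g (succMaxChain s mx zero j) := congrArg Fin.val hgij
  exact hne _ (hgn _) (succMaxChain s mx zero j) (succMaxChain s mx zero i)
    ⟨hg _, hgeq ▸ hg _, succ_succMaxChain_le_of_lt hrefl hleft hright zero hlt⟩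

theorem stmt9 {M : Type*} (n : ℕ) (f s : M → M) (mx : M → M → M)
    (le : M → M → Prop) (zero : M)
    (hC1 : ∀ a, le a a)
    (hC2 : ∀ a b c, le (mx a b) c → le a c)
    (hC3 : ∀ a b c, le (mx a b) c → le b c)
    (hC4 : ∀ k ≤ n, ∀ a b, ¬ (f b = num s zero k ∧ f a = num s zero k ∧ le (s b) a))
    (hC5 : ∀ a, ∃ i ≤ n, f a = num s zero i)
    (b : ℕ → ℕ) (hb : Set.BijOn b (Set.Iic n) (Set.Iic n)) :
    ∀ k ≤ n, ∀ (x : ℕ → M) (z : M),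
      (∀ i ≤ k, f (x (b i)) = num s zero (b i)) →
      ∃ i, k < i ∧ i ≤ n ∧ f (itm s mx n x z) = num s zero (b i) := by
  exact (clauseSet_unsatisfiable n f s mx le zero hC1 hC2 hC3 hC4 hC5).elim
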